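/- (Theorem 7.) Let n ≥ 3, let K = ℚ(p,q), let S ⊆ ℤ be a finite set of (pairwise distinct) integers, and let A be the K-linear span of {e_i : i ∈ S}. Suppose A is closed under the (p,q)-deformed Virasoro–Witt n-bracket, the Filippov fundamental identity holds for all elements of A, and the bracket does not vanish identically on A. Then |S| = n and Σ_{i ∈ S} i ∈ S; consequently A, with the restricted bracket, is isomorphic to the n-Lie algebra with basis B₁, …, B_n and bracket [B₁, …, B_n] = B₁. -/

import Mathlib

/-- The structure constant `c_n(i_1,…,i_n) = (p q⁻¹)^{⌊(n−1)/2⌋·(i_1+⋯+i_n)} · det M`,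
where `M_{r,j} = p^{(r − 2⌊(n−1)/2⌋)·i_j} q^{r·i_j}` for `r = 0,…,n−1`, `j = 1,…,n`. -/
noncomputable def vwC {K : Type*} [Field K] (p q : K) (n : ℕ) (i : Fin n → ℤ) : K :=
  (p * q⁻¹) ^ (((((n - 1) / 2 : ℕ) : ℤ)) * ∑ j, i j) *
    Matrix.det (Matrix.of fun r j : Fin n =>
      p ^ (((r : ℤ) - 2 * (((n - 1) / 2 : ℕ) : ℤ)) * i j) * q ^ ((r : ℤ) * i j))

/-- The `(p,q)`-deformed Virasoro–Witt `n`-bracket: the (alternating) `n`-multilinear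
map on the free module `ℤ →₀ K` determined on basis vectors by
`[e_{i_1},…,e_{i_n}] = c_n(i_1,…,i_n) • e_{i_1+⋯+i_n}`. -/
noncomputable def vwBr {K : Type*} [Field K] (p q : K) (n : ℕ)
    (v : Fin n → (ℤ →₀ K)) : ℤ →₀ K :=
  ∑ f ∈ Fintype.piFinset (fun j => (v j).support),
    ((∏ j, v j (f j)) * vwC p q n f) • Finsupp.single (∑ j, f j) (1 : K)

/-- The Filippov fundamental identity for the tuples `(Y₁,…,Y_{n−1})` (the first `n−1`
components of `Y`) and `(X₁,…,X_n)`: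
`[Y_1,…,Y_{n−1},[X_1,…,X_n]] = Σ_{k=1}^n [X_1,…,[Y_1,…,Y_{n−1},X_k],…,X_n]`. -/
noncomputable def holdsFI {K : Type*} [Field K] (p q : K) (n : ℕ) (hn : 0 < n)
    (Y X : Fin n → (ℤ →₀ K)) : Prop :=
  vwBr p q n (Function.update Y ⟨n - 1, Nat.sub_lt hn Nat.one_pos⟩ (vwBr p q n X)) =
    ∑ k : Fin n, vwBr p q n (Function.update X k
      (vwBr p q n (Function.update Y ⟨n - 1, Nat.sub_lt hn Nat.one_pos⟩ (X k))))

/-- The alternating `n`-multilinear bracket on `Fin n → K` determined by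
`[B₁,…,B_n] = B₁` on the standard basis. -/
def modelBr (K : Type*) [Field K] (n : ℕ) (v : Fin n → (Fin n → K)) : Fin n → K :=
  Matrix.det (Matrix.of fun r j : Fin n => v r j) •
    (fun t : Fin n => if (t : ℕ) = 0 then (1 : K) else 0)

/-- The field `K = ℚ(p,q)` of rational functions in two variables over `ℚ`. -/
abbrev Kpq : Type := FractionRing (MvPolynomial (Fin 2) ℚ)

/-- The image of the first variable `p` in `ℚ(p,q)`. -/
noncomputable def pVar : Kpq :=
  algebraMap (MvPolynomial (Fin 2) ℚ) Kpq (MvPolynomial.X 0)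

/-- The image of the second variable `q` in `ℚ(p,q)`. -/
noncomputable def qVar : Kpq :=
  algebraMap (MvPolynomial (Fin 2) ℚ) Kpq (MvPolynomial.X 1)


section VWaux
variable {K : Type*} [Field K]

theorem vwC_eq (p q : K) (hp : p ≠ 0) (hq : q ≠ 0) (n : ℕ) (i : Fin n → ℤ) :
    vwC p q n i = (p * q) ^ (-((((n - 1) / 2 : ℕ) : ℤ) * ∑ j, i j)) *
      (Matrix.vandermonde (fun j => (p * q) ^ (i j))).det := by
  unfold vwC
  generalize (((n - 1) / 2 : ℕ) : ℤ) = m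
  have h : (Matrix.of fun r j : Fin n =>
      p ^ (((r : ℤ) - 2 * m) * i j) * q ^ ((r : ℤ) * i j)) =
      Matrix.of fun r j : Fin n => (p ^ (-(2 * m) * i j)) *
        (Matrix.vandermonde (fun j => (p * q) ^ (i j))).transpose r j := by
    ext r j
    simp only [Matrix.of_apply, Matrix.transpose_apply, Matrix.vandermonde_apply]
    rw [← zpow_natCast, ← zpow_mul, mul_zpow, ← mul_assoc, ← zpow_add₀ hp]
    congr 2 <;> ring
  rw [h, Matrix.det_mul_row, Matrix.det_transpose, ← mul_assoc]
  congr 1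
  have h2 : ∏ j, p ^ (-(2 * m) * i j) = p ^ (-(2 * m) * ∑ j, i j) := by
    rw [Finset.mul_sum]
    generalize (Finset.univ : Finset (Fin n)) = s
    induction s using Finset.induction_on with
    | empty => simp
    | insert a s ha ih => rw [Finset.prod_insert ha, Finset.sum_insert ha, zpow_add₀ hp, ih]
  rw [h2, mul_zpow, mul_zpow, inv_zpow, ← zpow_neg, mul_right_comm, ← zpow_add₀ hp]
  congr 2
  ring

theorem vwC_ne_zero (p q : K) (hp : p ≠ 0) (hq : q ≠ 0)
    (ht : Function.Injective (fun k : ℤ => (p * q) ^ k)) (n : ℕ) (i : Fin n → ℤ)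
    (hi : Function.Injective i) : vwC p q n i ≠ 0 := by
  rw [vwC_eq p q hp hq]
  refine mul_ne_zero (zpow_ne_zero _ (mul_ne_zero hp hq)) ?_
  rw [Matrix.det_vandermonde_ne_zero_iff]
  exact ht.comp hi

theorem vwC_eq_zero (p q : K) (n : ℕ) (i : Fin n → ℤ)
    (hi : ¬ Function.Injective i) : vwC p q n i = 0 := by
  unfold vwC
  simp only [Function.Injective, not_forall] at hi
  obtain ⟨a, b, hab, hne⟩ := hi
  rw [Matrix.det_zero_of_column_eq hne, mul_zero]
  intro r
  simp [hab]

theorem vwC_perm (p q : K) (n : ℕ) (i : Fin n → ℤ) (π : Equiv.Perm (Fin n)) :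
    vwC p q n (fun j => i (π j)) = (Equiv.Perm.sign π : ℤ) * vwC p q n i := by
  unfold vwC
  rw [Equiv.sum_comp π i]
  have := Matrix.det_permute' π (Matrix.of fun r j : Fin n =>
      p ^ (((r : ℤ) - 2 * (((n - 1) / 2 : ℕ) : ℤ)) * i j) * q ^ ((r : ℤ) * i j))
  have h2 : (Matrix.of fun r j : Fin n =>
      p ^ (((r : ℤ) - 2 * (((n - 1) / 2 : ℕ) : ℤ)) * i (π j)) * q ^ ((r : ℤ) * i (π j))) =
    (Matrix.of fun r j : Fin n =>
      p ^ (((r : ℤ) - 2 * (((n - 1) / 2 : ℕ) : ℤ)) * i j) * q ^ ((r : ℤ) * i j)).submatrix id π := rfl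
  rw [h2, this]
  ring

theorem vwBr_single (p q : K) (n : ℕ) (h : Fin n → ℤ) (w : Fin n → K) :
    vwBr p q n (fun j => Finsupp.single (h j) (w j)) =
      ((∏ j, w j) * vwC p q n h) • Finsupp.single (∑ j, h j) (1 : K) := by
  unfold vwBr
  rw [Finset.sum_eq_single h]
  · simp
  · intro f hf hne
    exfalso
    apply hne
    funext j
    have := Fintype.mem_piFinset.1 hf j
    have := Finsupp.support_single_subset this
    simpa using this
  · intro hh
    simp only [Fintype.mem_piFinset, not_forall] at hh
    obtain ⟨j, hj⟩ := hh
    have : w j = 0 := by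
      by_contra hw
      exact hj (by simp [hw])
    rw [Finset.prod_eq_zero (Finset.mem_univ j)]
    · simp
    · simp [this]

theorem vwBr_det (p q : K) (n : ℕ) (σ : Fin n → ℤ) (hσ : Function.Injective σ)
    (v : Fin n → (ℤ →₀ K)) (hv : ∀ j, ∀ x ∈ (v j).support, x ∈ Set.range σ) :
    vwBr p q n v = ((Matrix.of fun r j : Fin n => v r (σ j)).det * vwC p q n σ) •
      Finsupp.single (∑ j, σ j) (1 : K) := by
  unfold vwBr
  set F : (Fin n → ℤ) → (ℤ →₀ K) := fun f =>
    ((∏ j, v j (f j)) * vwC p q n f) • Finsupp.single (∑ j, f j) (1 : K) with hF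
  have h1 : ∑ f ∈ Fintype.piFinset (fun j => (v j).support), F f =
      ∑ π : Equiv.Perm (Fin n), F (fun j => σ (π j)) := by
    symm
    refine Finset.sum_bij_ne_zero (fun (π : Equiv.Perm (Fin n)) _ _ => fun j => σ (π j))
      ?_ ?_ ?_ ?_
    · intro π _ hne
      rw [Fintype.mem_piFinset]
      intro j
      rw [Finsupp.mem_support_iff]
      intro h0
      apply hne
      simp only [hF]
      rw [Finset.prod_eq_zero (Finset.mem_univ j) h0]
      simp
    · intro π _ _ π' _ _ h
      ext j
      exact congrArg Fin.val (hσ (congrFun h j))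
    · intro f hf hne
      have hinj : Function.Injective f := by
        by_contra hni
        apply hne
        simp only [hF]
        rw [vwC_eq_zero p q n f hni]
        simp
      have hr : ∀ j, ∃ k, σ k = f j := fun j => hv j _ (Fintype.mem_piFinset.1 hf j)
      choose g hg using hr
      have hgi : Function.Injective g := by
        intro a b hab
        apply hinj
        rw [← hg, ← hg, hab]
      have hfe : (fun j => σ (Equiv.ofBijective g (Finite.injective_iff_bijective.1 hgi) j)) = f := by
        funext j
        simp [hg]
      refine ⟨Equiv.ofBijective g (Finite.injective_iff_bijective.1 hgi), Finset.mem_univ _, ?_, hfe⟩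
      rw [hfe]
      exact hne
    · intros
      rfl
  rw [h1]
  simp only [hF]
  rw [← Matrix.det_transpose, Matrix.det_apply', Finset.sum_mul, Finset.sum_smul]
  refine Finset.sum_congr rfl fun π _ => ?_
  rw [vwC_perm, Equiv.sum_comp π σ]
  congr 1
  simp only [Matrix.transpose_apply, Matrix.of_apply]
  ring

theorem enum_lemma (n : ℕ) (U : Finset ℤ) (hU : U.card = n) (k : Fin n) (a : ℤ) (ha : a ∈ U) :
    ∃ f : Fin n → ℤ, Function.Injective f ∧ Finset.univ.image f = U ∧ f k = a := by
  let e : Fin n ≃ U := (U.equivFinOfCardEq hU).symm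
  let e' : Fin n ≃ U := (Equiv.swap k (e.symm ⟨a, ha⟩)).trans e
  refine ⟨fun j => (e' j : ℤ), Subtype.val_injective.comp e'.injective, ?_, ?_⟩
  · ext x
    simp only [Finset.mem_image, Finset.mem_univ, true_and]
    constructor
    · rintro ⟨j, rfl⟩
      exact (e' j).2
    · intro hx
      exact ⟨e'.symm ⟨x, hx⟩, by simp⟩
  · simp [e']

theorem vand_last (k : ℕ) (x : Fin (k + 1) → K) :
    (Matrix.vandermonde x).det =
      (∏ i : Fin k, (x (Fin.last k) - x i.castSucc)) *
        (Matrix.vandermonde (fun i : Fin k => x i.castSucc)).det := by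
  rw [Matrix.det_vandermonde, Matrix.det_vandermonde, Fin.prod_univ_castSucc]
  have h : ∀ i : Fin k, ∏ j ∈ Finset.Ioi i.castSucc, (x j - x i.castSucc) =
     (x (Fin.last k) - x i.castSucc) * ∏ j ∈ Finset.Ioi i, (x j.castSucc - x i.castSucc) := by
    intro i
    have : Finset.Ioi i.castSucc = insert (Fin.last k) ((Finset.Ioi i).map Fin.castSuccEmb) := by
      ext j
      refine Fin.lastCases ?_ (fun j => ?_) j
      · simp [Fin.castSucc_lt_last]
      · simp
        intro h
        exact Fin.le_last _
    rw [this, Finset.prod_insert (by simp), Finset.prod_map]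
    rfl
  have h0 : Finset.Ioi (Fin.last k) = ∅ := by
    ext j; simp [Fin.le_last]
  rw [h0]
  simp [h, Finset.prod_mul_distrib]

theorem comb_lemma (n : ℕ) (hn : 3 ≤ n) (S : Finset ℤ)
    (hS : ∀ U ⊆ S, U.card = n → ∑ i ∈ U, i ∈ S) (hc : n < S.card) :
    S.card = n + 1 ∧ ∑ i ∈ S, i = 0 ∧ ∀ s ∈ S, -s ∈ S := by
  have hne : S.Nonempty := Finset.card_pos.1 (by omega)
  set M := S.max' hne
  set μ := S.min' hne
  have hM : M ∈ S := S.max'_mem hne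
  have hμ : μ ∈ S := S.min'_mem hne
  have hlt : μ < M := Finset.min'_lt_max'_of_card S (by omega)
  set T := (S.erase M).erase μ with hT
  have hTc : T.card = S.card - 2 := by
    rw [hT, Finset.card_erase_of_mem (Finset.mem_erase.2 ⟨hlt.ne, hμ⟩),
      Finset.card_erase_of_mem hM]
    omega
  have hTS : T ⊆ S := (Finset.erase_subset _ _).trans (Finset.erase_subset _ _)
  have hMT : M ∉ T := by simp [hT]
  have hμT : μ ∉ T := by simp [hT]
  have key : ∀ U ⊆ T, U.card = n - 1 → ∑ i ∈ U, i = 0 := by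
    intro U hU hUc
    have h1 := hS (insert M U) (Finset.insert_subset hM (hU.trans hTS))
      (by rw [Finset.card_insert_of_notMem (fun h => hMT (hU h))]; omega)
    have h2 := hS (insert μ U) (Finset.insert_subset hμ (hU.trans hTS))
      (by rw [Finset.card_insert_of_notMem (fun h => hμT (hU h))]; omega)
    rw [Finset.sum_insert (fun h => hMT (hU h))] at h1
    rw [Finset.sum_insert (fun h => hμT (hU h))] at h2
    have h3 := S.le_max' _ h1
    have h4 := S.min'_le _ h2
    change _ ≤ M at h3
    change μ ≤ _ at h4
    omega
  have hcard : S.card = n + 1 := by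
    by_contra hcon
    obtain ⟨W, hWT, hWc⟩ := Finset.exists_subset_card_eq (s := T) (n := n) (by omega)
    have hw : ∀ w ∈ W, w = ∑ i ∈ W, i := by
      intro w hw
      have := key (W.erase w) ((Finset.erase_subset _ _).trans hWT)
        (by rw [Finset.card_erase_of_mem hw, hWc])
      rw [← Finset.add_sum_erase W (fun i => i) hw, this]
      simp
    obtain ⟨x, hx, y, hy, hxy⟩ := Finset.one_lt_card.1 (by omega : 1 < W.card)
    exact hxy ((hw x hx).trans (hw y hy).symm)
  set Tot := ∑ i ∈ S, i with hTot
  have hinv : ∀ s ∈ S, Tot - s ∈ S := by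
    intro s hs
    have := hS (S.erase s) (Finset.erase_subset _ _)
      (by rw [Finset.card_erase_of_mem hs, hcard]; rfl)
    have h2 := Finset.add_sum_erase S (fun i => i) hs
    rwa [show Tot - s = ∑ i ∈ S.erase s, i by rw [hTot]; omega]
  have hsum : ∑ s ∈ S, (Tot - s) = ∑ s ∈ S, s :=
    Finset.sum_bij' (fun s _ => Tot - s) (fun s _ => Tot - s) hinv hinv
      (by intros; ring) (by intros; ring) (by intros; ring)
  rw [Finset.sum_sub_distrib, Finset.sum_const, ← hTot, hcard, nsmul_eq_mul] at hsum
  have h0 : Tot = 0 := by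
    have : ((n : ℤ) - 1) * Tot = 0 := by push_cast at hsum; linarith
    rcases mul_eq_zero.1 this with h | h
    · omega
    · exact h
  refine ⟨hcard, h0, fun s hs => ?_⟩
  have := hinv s hs
  rwa [h0, zero_sub] at this


theorem prod_flip (t : K) (ht : t ≠ 0) (Y : Finset ℤ) (hneg : ∀ y ∈ Y, -y ∈ Y)
    (hsum : ∑ y ∈ Y, y = 0) (a : ℤ) :
    ∏ y ∈ Y, (t ^ (-a) - t ^ y) =
      (-1) ^ Y.card * t ^ (-(Y.card : ℤ) * a) * ∏ y ∈ Y, (t ^ a - t ^ y) := by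
  have h1 : ∏ y ∈ Y, (t ^ (-a) - t ^ y) = ∏ y ∈ Y, (t ^ (-a) - t ^ (-y)) :=
    Finset.prod_bij' (fun y _ => -y) (fun y _ => -y) hneg hneg (by simp) (by simp) (by simp)
  have h2 : ∀ y ∈ Y, (t ^ (-a) - t ^ (-y)) = ((-1) * t ^ (-a)) * t ^ (-y) * (t ^ a - t ^ y) := by
    intro y _
    rw [zpow_neg, zpow_neg]
    have := zpow_ne_zero a ht
    have := zpow_ne_zero y ht
    field_simp
    ring
  have h3 : ∏ y ∈ Y, t ^ (-y) = t ^ (- ∑ y ∈ Y, y) := by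
    rw [← Finset.sum_neg_distrib]
    clear h1 h2 hsum hneg
    induction Y using Finset.induction_on with
    | empty => simp
    | insert b s hb ih => rw [Finset.prod_insert hb, Finset.sum_insert hb, zpow_add₀ ht, ih]
  rw [h1, Finset.prod_congr rfl h2, Finset.prod_mul_distrib, Finset.prod_mul_distrib, h3, hsum,
    Finset.prod_const, mul_pow, ← zpow_natCast (t ^ (-a)), ← zpow_mul]
  simp [mul_comm]

theorem vwC_last (p q : K) (hp : p ≠ 0) (hq : q ≠ 0) (k : ℕ) (f : Fin (k + 1) → ℤ) :
    vwC p q (k + 1) f = (p * q) ^ (-(((k / 2 : ℕ) : ℤ) * ∑ j, f j)) *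
      ((∏ i : Fin k, ((p * q) ^ f (Fin.last k) - (p * q) ^ f i.castSucc)) *
        (Matrix.vandermonde (fun i : Fin k => (p * q) ^ f i.castSucc)).det) := by
  rw [vwC_eq p q hp hq, vand_last]
  rfl

/-- The two opposite eigenvalues do not cancel. -/
theorem lam_mu_ne (p q : K) (hp : p ≠ 0) (hq : q ≠ 0) (h2 : (2 : K) ≠ 0)
    (ht : Function.Injective (fun k : ℤ => (p * q) ^ k)) (k : ℕ) (f : Fin (k + 1) → ℤ)
    (hf : Function.Injective f) (Y : Finset ℤ)
    (hY : Finset.univ.image (fun i : Fin k => f i.castSucc) = Y)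
    (hneg : ∀ y ∈ Y, -y ∈ Y) (hsum : ∑ y ∈ Y, y = 0) (a : ℤ) (ha : a ≠ 0)
    (hfa : f (Fin.last k) = a) :
    vwC p q (k + 1) f + vwC p q (k + 1) (Function.update f (Fin.last k) (-a)) ≠ 0 := by
  have htt : p * q ≠ 0 := mul_ne_zero hp hq
  have hcs : Function.Injective (fun i : Fin k => f i.castSucc) :=
    hf.comp (Fin.castSucc_injective k)
  have hYc : Y.card = k := by
    rw [← hY, Finset.card_image_of_injective _ hcs]; simp
  have hs : ∑ i : Fin k, f i.castSucc = 0 := by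
    rw [← hsum, ← hY, Finset.sum_image (fun _ _ _ _ h => hcs h)]
  have hP : ∀ b : ℤ, ∏ i : Fin k, ((p * q) ^ b - (p * q) ^ f i.castSucc) =
      ∏ y ∈ Y, ((p * q) ^ b - (p * q) ^ y) := by
    intro b
    rw [← hY, Finset.prod_image (fun _ _ _ _ h => hcs h)]
  have hc := vwC_ne_zero p q hp hq ht _ f hf
  rw [vwC_last p q hp hq] at hc ⊢
  rw [vwC_last p q hp hq]
  have hu : ∀ i : Fin k, Function.update f (Fin.last k) (-a) i.castSucc = f i.castSucc := by
    intro i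
    rw [Function.update_of_ne (Fin.castSucc_lt_last i).ne]
  simp only [Fin.sum_univ_castSucc, hu, Function.update_self, hfa, hs, zero_add, hP] at hc ⊢
  rw [prod_flip (p * q) htt Y hneg hsum a, hYc]
  have hPV := right_ne_zero_of_mul hc
  set m : ℤ := ((k / 2 : ℕ) : ℤ) with hm
  set PV := (∏ y ∈ Y, ((p * q) ^ a - (p * q) ^ y)) *
    (Matrix.vandermonde (fun i : Fin k => (p * q) ^ f i.castSucc)).det with hPVd
  have heq : (p * q) ^ (-(m * a)) * PV + (p * q) ^ (-(m * -a)) *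
      ((-1) ^ k * (p * q) ^ (-(k : ℤ) * a) * (∏ y ∈ Y, ((p * q) ^ a - (p * q) ^ y)) *
        (Matrix.vandermonde (fun i : Fin k => (p * q) ^ f i.castSucc)).det) =
      ((p * q) ^ (-(m * a)) + (-1) ^ k * (p * q) ^ (m * a - k * a)) * PV := by
    rw [show m * a - k * a = -(m * -a) + -(k : ℤ) * a by ring, zpow_add₀ htt, hPVd]
    ring
  rw [heq]
  refine mul_ne_zero ?_ hPV
  rcases Nat.even_or_odd' k with ⟨c, hk | hk⟩
  · have hmc : m = c := by rw [hm]; omega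
    rw [hmc, hk, pow_mul]
    have : ((c : ℤ) * a - ((2 * c : ℕ) : ℤ) * a) = -(c * a) := by push_cast; ring
    rw [this]
    simp only [even_two, Even.neg_pow, one_pow, one_mul]
    rw [← two_mul]
    exact mul_ne_zero h2 (zpow_ne_zero _ htt)
  · have hmc : m = c := by rw [hm]; omega
    rw [hmc, hk, pow_succ, pow_mul]
    have : ((c : ℤ) * a - ((2 * c + 1 : ℕ) : ℤ) * a) = -(c * a) - a := by push_cast; ring
    rw [this]
    simp only [even_two, Even.neg_pow, one_pow, one_mul]
    intro h
    have h3 : (p * q) ^ (-(c * a)) = (p * q) ^ (-(c * a) - a) := by linear_combination h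
    have h4 := ht h3
    apply ha
    omega

/-- The Filippov identity fails on a symmetric set of `n + 1` integers. -/
theorem FI_fails (p q : K) (hp : p ≠ 0) (hq : q ≠ 0) (h2 : (2 : K) ≠ 0)
    (ht : Function.Injective (fun k : ℤ => (p * q) ^ k)) (k : ℕ) (hk : 2 ≤ k) (S : Finset ℤ)
    (hc : S.card = k + 2) (hsum : ∑ i ∈ S, i = 0) (hneg : ∀ s ∈ S, -s ∈ S)
    (hFI : ∀ f g : Fin (k + 1) → ℤ, (∀ j, f j ∈ S) → (∀ j, g j ∈ S) →
      holdsFI p q (k + 1) (by omega) (fun j => Finsupp.single (f j) (1 : K))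
        (fun j => Finsupp.single (g j) (1 : K))) : False := by
  obtain ⟨a, haS, ha⟩ : ∃ a ∈ S, a ≠ 0 :=
    Finset.exists_mem_ne (by omega) 0
  have hnaS := hneg a haS
  have hane : a ≠ -a := by omega
  obtain ⟨d, hd, hda, hdna⟩ : ∃ d ∈ S, d ≠ a ∧ d ≠ -a := by
    by_contra hcon
    push Not at hcon
    have : S ⊆ {a, -a} := by
      intro x hx
      by_cases h : x = a
      · simp [h]
      · simp [hcon x hx h]
    have := Finset.card_le_card this
    have := Finset.card_le_two (a := a) (b := -a)
    omega
  have herase : ∀ s ∈ S, (S.erase s).card = k + 1 ∧ ∑ i ∈ S.erase s, i = -s := by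
    intro s hs
    refine ⟨by rw [Finset.card_erase_of_mem hs, hc]; rfl, ?_⟩
    have := Finset.add_sum_erase S (fun i => i) hs
    omega
  obtain ⟨f, hf, hfi, hfl⟩ := enum_lemma (k + 1) (S.erase (-a)) (herase _ hnaS).1 (Fin.last k) a
    (Finset.mem_erase.2 ⟨hane, haS⟩)
  obtain ⟨g, hg, hgi, -⟩ := enum_lemma (k + 1) (S.erase d) (herase _ hd).1 (Fin.last k) a
    (Finset.mem_erase.2 ⟨hda.symm, haS⟩)
  have hfS : ∀ j, f j ∈ S.erase (-a) := fun j => hfi ▸ Finset.mem_image_of_mem f (Finset.mem_univ j)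
  have hgS : ∀ j, g j ∈ S.erase d := fun j => hgi ▸ Finset.mem_image_of_mem g (Finset.mem_univ j)
  have hsf : ∑ j, f j = a := by
    have := (herase _ hnaS).2
    rw [← hfi, Finset.sum_image (fun _ _ _ _ h => hf h), neg_neg] at this
    exact this
  have hsg : ∑ j, g j = -d := by
    have := (herase _ hd).2
    rw [← hgi, Finset.sum_image (fun _ _ _ _ h => hg h)] at this
    exact this
  have hYi : Finset.univ.image (fun i : Fin k => f i.castSucc) = (S.erase (-a)).erase a := by
    ext x
    rw [← hfi]
    simp only [Finset.mem_image, Finset.mem_univ, true_and, Finset.mem_erase]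
    constructor
    · rintro ⟨i, rfl⟩
      refine ⟨?_, i.castSucc, rfl⟩
      rw [← hfl]
      exact fun h => (Fin.castSucc_lt_last i).ne (hf h)
    · rintro ⟨hx, j, rfl⟩
      induction j using Fin.lastCases with
      | last => exact absurd hfl hx
      | cast i => exact ⟨i, rfl⟩
  have hlm := lam_mu_ne p q hp hq h2 ht k f hf _ hYi
    (by
      intro y hy
      simp only [Finset.mem_erase] at hy ⊢
      exact ⟨by omega, by omega, hneg y hy.2.2⟩)
    (by
      have h1 := Finset.add_sum_erase (S.erase (-a)) (fun i => i) (Finset.mem_erase.2 ⟨hane, haS⟩)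
      have h3 := (herase _ hnaS).2
      omega) a ha hfl
  set lam := vwC p q (k + 1) f with hlam
  set mu := vwC p q (k + 1) (Function.update f (Fin.last k) (-a)) with hmu
  have hupd : ∀ (h : Fin (k + 1) → ℤ) (w : Fin (k + 1) → K) (i : Fin (k + 1)) (x : ℤ) (c : K),
      Function.update (fun j => Finsupp.single (h j) (w j)) i (Finsupp.single x c) =
      fun j => Finsupp.single (Function.update h i x j) (Function.update w i c j) := by
    intro h w i x c
    funext j
    by_cases hj : j = i
    · subst hj; simp
    · simp [Function.update_of_ne hj]
  have hlast : (⟨k + 1 - 1, Nat.sub_lt (by omega : 0 < k + 1) Nat.one_pos⟩ : Fin (k + 1)) =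
      Fin.last k := rfl
  have hzero : ∀ x ∈ (S.erase (-a)).erase a,
      vwC p q (k + 1) (Function.update f (Fin.last k) x) = 0 := by
    intro x hx
    apply vwC_eq_zero
    rw [← hYi] at hx
    simp only [Finset.mem_image, Finset.mem_univ, true_and] at hx
    obtain ⟨i, rfl⟩ := hx
    intro hinj
    have := @hinj i.castSucc (Fin.last k) (by
      rw [Function.update_of_ne (Fin.castSucc_lt_last i).ne, Function.update_self])
    exact (Fin.castSucc_lt_last i).ne this
  -- the inner adjoint action
  have had : ∀ j, vwBr p q (k + 1) (Function.update (fun j => Finsupp.single (f j) (1 : K))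
      (Fin.last k) (Finsupp.single (g j) (1 : K))) =
      Finsupp.single (g j) (if g j = a then lam else if g j = -a then mu else 0) := by
    intro j
    rw [hupd, vwBr_single]
    have h1 : (∏ i, Function.update (fun _ : Fin (k + 1) => (1 : K)) (Fin.last k) 1 i) = 1 := by
      rw [Function.update_eq_self_iff.2 rfl]; simp
    rw [h1, one_mul]
    split_ifs with h3 h4
    · rw [h3, ← hfl, Function.update_eq_self, hsf, hfl]
      simp [hlam]
    · rw [h4]
      have : ∑ i, Function.update f (Fin.last k) (-a) i = -a := by
        rw [Fin.sum_univ_castSucc] at hsf ⊢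
        rw [Function.update_self]
        have : ∀ i : Fin k, Function.update f (Fin.last k) (-a) i.castSucc = f i.castSucc :=
          fun i => Function.update_of_ne (Fin.castSucc_lt_last i).ne _ _
        simp only [this]
        omega
      rw [this]
      simp [hmu]
    · rw [hzero]
      · simp
      · exact Finset.mem_erase.2 ⟨h3, Finset.mem_erase.2 ⟨h4, Finset.mem_of_mem_erase (hgS j)⟩⟩
  have hfin := hFI f g (fun j => Finset.mem_of_mem_erase (hfS j))
    (fun j => Finset.mem_of_mem_erase (hgS j))
  unfold holdsFI at hfin
  rw [hlast] at hfin
  simp only [had] at hfin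
  rw [vwBr_single, hsg] at hfin
  have hL : ((∏ j : Fin (k + 1), (1 : K)) * vwC p q (k + 1) g) • Finsupp.single (-d) (1 : K) =
      Finsupp.single (-d) (vwC p q (k + 1) g) := by simp
  rw [hL, hupd, vwBr_single, hzero (-d)
    (Finset.mem_erase.2 ⟨by omega, Finset.mem_erase.2 ⟨by omega, hneg d hd⟩⟩), mul_zero,
    zero_smul] at hfin
  simp only [hupd, vwBr_single, Function.update_eq_self, Finset.prod_update_of_mem (Finset.mem_univ _),
    Finset.prod_const_one, mul_one] at hfin
  rw [← Finset.sum_smul, ← Finset.sum_mul] at hfin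
  have hcoef := congrArg (fun x => x (∑ j, g j)) hfin
  simp only [Finsupp.coe_zero, Pi.zero_apply, Finsupp.smul_apply, Finsupp.single_eq_same,
    smul_eq_mul, mul_one] at hcoef
  have hs0 : ∑ j, (if g j = a then lam else if g j = -a then mu else 0) = lam + mu := by
    have : ∑ j, (if g j = a then lam else if g j = -a then mu else 0) =
        ∑ x ∈ S.erase d, (if x = a then lam else if x = -a then mu else 0) := by
      rw [← hgi, Finset.sum_image (fun _ _ _ _ h => hg h)]
    rw [this]
    have hsplit : ∀ x : ℤ, (if x = a then lam else if x = -a then mu else 0) =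
        (if x = a then lam else 0) + (if x = -a then mu else 0) := by
      intro x
      split_ifs with h1 h3 <;> first | (exfalso; omega) | simp
    simp only [hsplit, Finset.sum_add_distrib, Finset.sum_ite_eq', Finset.mem_erase]
    simp [haS, hnaS, hda.symm, hdna.symm]
  rw [hs0] at hcoef
  exact mul_ne_zero hlm (vwC_ne_zero p q hp hq ht _ g hg) hcoef.symm

end VWaux

theorem tmul_ne : pVar * qVar ≠ 0 := by
  have hinj : Function.Injective (algebraMap (MvPolynomial (Fin 2) ℚ) Kpq) :=
    IsFractionRing.injective _ _
  unfold pVar qVar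
  rw [← map_mul]
  intro h
  have h1 := hinj (h.trans (map_zero _).symm)
  exact mul_ne_zero (MvPolynomial.X_ne_zero _) (MvPolynomial.X_ne_zero _) h1

theorem tpow_inj : Function.Injective (fun k : ℤ => (pVar * qVar) ^ k) := by
  have hne : (MvPolynomial.X 0 * MvPolynomial.X 1 : MvPolynomial (Fin 2) ℚ) ≠ 0 :=
    mul_ne_zero (MvPolynomial.X_ne_zero _) (MvPolynomial.X_ne_zero _)
  have hT : pVar * qVar = algebraMap (MvPolynomial (Fin 2) ℚ) Kpq
      (MvPolynomial.X 0 * MvPolynomial.X 1) := by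
    rw [map_mul]; rfl
  have hinj : Function.Injective (algebraMap (MvPolynomial (Fin 2) ℚ) Kpq) :=
    IsFractionRing.injective _ _
  have ht0 : pVar * qVar ≠ 0 := by
    rw [hT]
    exact fun h => hne (hinj (by rw [h, map_zero]))
  have hnat : ∀ k : ℕ, (pVar * qVar) ^ k = 1 → k = 0 := by
    intro k hk
    rw [hT, ← map_pow, ← map_one (algebraMap (MvPolynomial (Fin 2) ℚ) Kpq)] at hk
    have h1 := congrArg (MvPolynomial.eval (fun _ => (2 : ℚ))) (hinj hk)
    simp only [map_pow, map_mul, MvPolynomial.eval_X, map_one] at h1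
    by_contra h0
    have : (1 : ℚ) < (2 * 2) ^ k := one_lt_pow₀ (by norm_num) h0
    linarith
  have hint : ∀ k : ℤ, (pVar * qVar) ^ k = 1 → k = 0 := by
    intro k hk
    obtain ⟨m, rfl | rfl⟩ := k.eq_nat_or_neg
    · rw [zpow_natCast] at hk
      simp [hnat m hk]
    · rw [zpow_neg, inv_eq_one, zpow_natCast] at hk
      simp [hnat m hk]
  intro a b hab
  simp only at hab
  have := hint (a - b) (by rw [zpow_sub₀ ht0, hab, div_self (zpow_ne_zero _ ht0)])
  omega

/-- **Theorem 7.** Let `n ≥ 3`, `K = ℚ(p,q)`, `S ⊆ ℤ` finite, and let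
`A` be the span of `{e_i : i ∈ S}`. If `A` is closed under the `(p,q)`-deformed
Virasoro–Witt `n`-bracket, the Filippov fundamental identity holds on `A`, and the
bracket does not vanish identically on `A`, then `|S| = n`, `Σ_{i∈S} i ∈ S`, and `A`
with the restricted bracket is isomorphic to the `n`-Lie algebra with basis
`B₁,…,B_n` and bracket `[B₁,…,B_n] = B₁`. -/
theorem finite_n_Lie_subalgebra_classification
    (n : ℕ) (hn : 3 ≤ n) (S : Finset ℤ)
    (A : Submodule Kpq (ℤ →₀ Kpq))
    (hA : A = Submodule.span Kpq ((fun i : ℤ => Finsupp.single i (1 : Kpq)) '' ↑S))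
    (hclosed : ∀ v : Fin n → (ℤ →₀ Kpq), (∀ j, v j ∈ A) → vwBr pVar qVar n v ∈ A)
    (hFI : ∀ Y X : Fin n → (ℤ →₀ Kpq), (∀ j, Y j ∈ A) → (∀ j, X j ∈ A) →
      holdsFI pVar qVar n (by omega) Y X)
    (hnonzero : ∃ v : Fin n → (ℤ →₀ Kpq), (∀ j, v j ∈ A) ∧ vwBr pVar qVar n v ≠ 0) :
    S.card = n ∧ (∑ i ∈ S, i) ∈ S ∧
      ∃ φ : A ≃ₗ[Kpq] (Fin n → Kpq), ∀ v : Fin n → A,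
        φ ⟨vwBr pVar qVar n (fun j => (v j : ℤ →₀ Kpq)),
            hclosed _ (fun j => (v j).2)⟩ =
          modelBr Kpq n (fun j => φ (v j)) := by
  obtain ⟨k, rfl⟩ : ∃ k, n = k + 1 := ⟨n - 1, by omega⟩
  have hp : pVar ≠ 0 := left_ne_zero_of_mul tmul_ne
  have hq : qVar ≠ 0 := right_ne_zero_of_mul tmul_ne
  have ht := tpow_inj
  have hAmem : ∀ v : ℤ →₀ Kpq, v ∈ A ↔ ∀ x ∈ v.support, x ∈ S := by
    intro v
    rw [hA, ← Finsupp.supported_eq_span_single, Finsupp.mem_supported]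
    rfl
  have hsingle : ∀ i ∈ S, Finsupp.single i (1 : Kpq) ∈ A := by
    intro i hi
    rw [hA]
    exact Submodule.subset_span ⟨i, hi, rfl⟩
  have hsums : ∀ U ⊆ S, U.card = k + 1 → ∑ i ∈ U, i ∈ S := by
    intro U hU hUc
    obtain ⟨a, ha⟩ : U.Nonempty := Finset.card_pos.1 (by omega)
    obtain ⟨f, hf, hfi, -⟩ := enum_lemma (k + 1) U hUc 0 a ha
    have h1 := hclosed (fun j => Finsupp.single (f j) (1 : Kpq))
      (fun j => hsingle _ (hU (hfi ▸ Finset.mem_image_of_mem f (Finset.mem_univ j))))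
    rw [vwBr_single, hAmem] at h1
    have h2 := h1 (∑ j, f j) (by
      simp [vwC_ne_zero pVar qVar hp hq ht _ f hf])
    rwa [← hfi, Finset.sum_image (fun _ _ _ _ h => hf h)]
  have hge : k + 1 ≤ S.card := by
    obtain ⟨v, hv, hne⟩ := hnonzero
    by_contra hlt
    apply hne
    unfold vwBr
    refine Finset.sum_eq_zero fun f hf => ?_
    rw [vwC_eq_zero, mul_zero, zero_smul]
    intro hinj
    have h1 : Finset.univ.image f ⊆ S := by
      intro x hx
      simp only [Finset.mem_image, Finset.mem_univ, true_and] at hx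
      obtain ⟨j, rfl⟩ := hx
      exact (hAmem _).1 (hv j) _ (Fintype.mem_piFinset.1 hf j)
    have h2 := Finset.card_le_card h1
    rw [Finset.card_image_of_injective _ hinj] at h2
    simp at h2
    omega
  have hcard : S.card = k + 1 := by
    by_contra hcon
    obtain ⟨h1, h2, h3⟩ := comb_lemma (k + 1) hn S hsums (by omega)
    exact FI_fails pVar qVar hp hq two_ne_zero ht k (by omega) S h1 h2 h3
      (fun f g hf hg => hFI _ _ (fun j => hsingle _ (hf j)) (fun j => hsingle _ (hg j)))
  have hmem : ∑ i ∈ S, i ∈ S := hsums S (Finset.Subset.refl _) hcard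
  refine ⟨hcard, hmem, ?_⟩
  obtain ⟨σ, hσ, hσi, hσ0⟩ := enum_lemma (k + 1) S hcard 0 _ hmem
  have hσS : ∀ j, σ j ∈ S := fun j => hσi ▸ Finset.mem_image_of_mem σ (Finset.mem_univ j)
  have hσr : ∀ x ∈ S, ∃ j, σ j = x := by
    intro x hx
    rw [← hσi] at hx
    simpa using hx
  have hσs : ∑ j, σ j = σ 0 := by
    rw [hσ0, ← hσi, Finset.sum_image (fun _ _ _ _ h => hσ h)]
  have hc := vwC_ne_zero pVar qVar hp hq ht _ σ hσ
  let i1 : Fin (k + 1) := ⟨1, by omega⟩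
  let α : Fin (k + 1) → Kpq := Function.update 1 i1 (vwC pVar qVar (k + 1) σ)
  have hα : ∀ j, α j ≠ 0 := by
    intro j
    by_cases hj : j = i1
    · subst hj; simpa [α] using hc
    · simp [α, Function.update_of_ne hj]
  have hαp : ∏ j, α j = vwC pVar qVar (k + 1) σ := by
    simp [α, Finset.prod_update_of_mem (Finset.mem_univ _)]
  have hα0 : α 0 = 1 := by
    simp only [α]
    rw [Function.update_of_ne]
    · rfl
    · intro h
      have := congrArg Fin.val h
      simp [i1] at this
  let L : A →ₗ[Kpq] (Fin (k + 1) → Kpq) :=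
    { toFun := fun v j => α j * (v : ℤ →₀ Kpq) (σ j)
      map_add' := by
        intro v w
        funext j
        simp [mul_add]
      map_smul' := by
        intro c v
        funext j
        simp [mul_left_comm] }
  have hL : ∀ v j, L v j = α j * (v : ℤ →₀ Kpq) (σ j) := fun _ _ => rfl
  have hbij : Function.Bijective L := by
    constructor
    · rw [injective_iff_map_eq_zero]
      intro v hv
      ext x
      by_contra hx
      obtain ⟨j, rfl⟩ := hσr x ((hAmem _).1 v.2 x (Finsupp.mem_support_iff.2 hx))
      have := congrFun hv j
      rw [hL] at this
      exact mul_ne_zero (hα j) hx this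
    · intro w
      refine ⟨⟨∑ j, (w j / α j) • Finsupp.single (σ j) (1 : Kpq),
        Submodule.sum_mem _ fun j _ => Submodule.smul_mem _ _ (hsingle _ (hσS j))⟩, ?_⟩
      funext i
      rw [hL]
      simp only [Finsupp.coe_finsetSum, Finset.sum_apply, Finsupp.smul_apply, smul_eq_mul]
      rw [Finset.sum_eq_single i]
      · simp [mul_div_cancel₀ _ (hα i)]
      · intro j _ hj
        rw [Finsupp.single_eq_of_ne (fun h => hj (hσ h.symm)), mul_zero]
      · simp
  refine ⟨LinearEquiv.ofBijective L hbij, fun v => ?_⟩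
  have hdet := vwBr_det pVar qVar (k + 1) σ hσ (fun j => (v j : ℤ →₀ Kpq))
    (fun j x hx => hσr x ((hAmem _).1 (v j).2 x hx))
  funext i
  simp only [LinearEquiv.ofBijective_apply, modelBr]
  rw [hL]
  simp only [hL, hdet, hσs]
  have hdm := Matrix.det_mul_row α (Matrix.of fun r j : Fin (k + 1) => (v r : ℤ →₀ Kpq) (σ j))
  simp only [Matrix.of_apply] at hdm
  rw [hdm, hαp]
  by_cases hi : i = 0
  · subst hi
    simp [hα0, mul_comm]
  · have : σ i ≠ σ 0 := fun h => hi (hσ h)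
    simp [hi, Finsupp.single_eq_of_ne this]
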